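/- arXiv:2603.07033 — 2 statements merged into one kernel-verified Lean document; each statement's English description precedes it below -/
import Mathlib

section
/- Let A be a finite-dimensional simple associative algebra over a field K. Then every element of [A,A], the K-linear span of all commutators [a,b] = ab − ba in A, is a sum of at most two commutators: for every z ∈ [A,A] there exist a₁,b₁,a₂,b₂ ∈ A with z = [a₁,b₁] + [a₂,b₂]. That is, the commutator width of A is at most 2. -/
open TensorProduct

lemma ar_phi {F L A ι : Type*} [DecidableEq ι] [Field F] [Field L] [Algebra F L] [Ring A] [Algebra F A]
    (b : Module.Basis ι F L) (a c : A) (x : L ⊗[F] A) (i : ι) :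
    TensorProduct.equivFinsuppOfBasisLeft b ((1 ⊗ₜ a) * x * (1 ⊗ₜ c)) i
      = a * TensorProduct.equivFinsuppOfBasisLeft b x i * c := by
  induction x using TensorProduct.induction_on with
  | zero => simp
  | tmul l y =>
    simp
  | add x y hx hy => simp only [mul_add, add_mul, map_add, Finsupp.add_apply, hx, hy]

theorem ar_simple_tensor (F L A : Type*) [Field F] [Field L] [Algebra F L] [Ring A] [Algebra F A]
    [IsSimpleRing A] [Algebra.IsCentral F A] : IsSimpleRing (L ⊗[F] A) := by
  classical
  have hnt : Nontrivial (L ⊗[F] A) := inferInstance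
  refine ⟨⟨fun I => ?_⟩⟩
  by_cases hI : I = ⊥
  · exact Or.inl hI
  right
  let b := Module.Basis.ofVectorSpace F L
  let φ := TensorProduct.equivFinsuppOfBasisLeft (N := A) b
  have hex : ∃ n : ℕ, ∃ x ∈ I, x ≠ 0 ∧ (φ x).support.card = n := by
    by_contra hcon
    apply hI
    rw [eq_bot_iff]
    intro x hx
    rw [TwoSidedIdeal.mem_bot]
    by_contra h0
    exact hcon ⟨_, x, hx, h0, rfl⟩
  obtain ⟨x, hxI, hx0, hxn⟩ := Nat.find_spec hex
  have hmin : ∀ y ∈ I, (φ y).support.card < (φ x).support.card → y = 0 := by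
    intro y hy hlt
    by_contra h0
    rw [hxn] at hlt
    exact Nat.find_min hex hlt ⟨y, hy, h0, rfl⟩
  have hφx : φ x ≠ 0 := by simpa using hx0
  obtain ⟨i0, hi0⟩ := Finsupp.ne_iff.1 hφx
  simp only [Finsupp.coe_zero, Pi.zero_apply] at hi0
  have hφ : ∀ (a c : A) x i, φ ((1 ⊗ₜ a) * x * (1 ⊗ₜ c)) i = a * φ x i * c := ar_phi b
  have hφl : ∀ (a : A) x i, φ ((1 ⊗ₜ a) * x) i = a * φ x i := by
    intro a x i
    simpa [← Algebra.TensorProduct.one_def] using hφ a 1 x i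
  have hφr : ∀ (a : A) x i, φ (x * (1 ⊗ₜ a)) i = φ x i * a := by
    intro a x i
    simpa [← Algebra.TensorProduct.one_def] using hφ 1 a x i
  let J : TwoSidedIdeal A := TwoSidedIdeal.mk'
    {r | ∃ y ∈ I, (∀ i, φ x i = 0 → φ y i = 0) ∧ φ y i0 = r}
    ⟨0, I.zero_mem, by simp, by simp⟩
    (by
      rintro _ _ ⟨y, hy, h1, rfl⟩ ⟨z, hz, h2, rfl⟩
      exact ⟨y + z, I.add_mem hy hz, fun i hi => by simp [h1 i hi, h2 i hi], by simp⟩)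
    (by
      rintro _ ⟨y, hy, h1, rfl⟩
      exact ⟨-y, I.neg_mem hy, fun i hi => by simp [h1 i hi], by simp⟩)
    (by
      rintro a _ ⟨y, hy, h1, rfl⟩
      exact ⟨(1 ⊗ₜ a) * y, I.mul_mem_left _ _ hy, fun i hi => by rw [hφl, h1 i hi, mul_zero],
        by rw [hφl]⟩)
    (by
      rintro _ a ⟨y, hy, h1, rfl⟩
      exact ⟨y * (1 ⊗ₜ a), I.mul_mem_right _ _ hy, fun i hi => by rw [hφr, h1 i hi, zero_mul],
        by rw [hφr]⟩)
  have h1J : (1 : A) ∈ J := IsSimpleRing.one_mem_of_ne_zero_mem J hi0 (by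
    rw [TwoSidedIdeal.mem_mk']
    exact ⟨x, hxI, fun _ h => h, rfl⟩)
  rw [TwoSidedIdeal.mem_mk'] at h1J
  obtain ⟨y, hyI, hys, hy1⟩ := h1J
  have hcomm : ∀ a : A, (1 ⊗ₜ a) * y - y * (1 ⊗ₜ a) = 0 := by
    intro a
    apply hmin _ (I.sub_mem (I.mul_mem_left _ _ hyI) (I.mul_mem_right _ _ hyI))
    apply Finset.card_lt_card
    rw [Finset.ssubset_iff_of_subset]
    · refine ⟨i0, by simpa using hi0, ?_⟩
      simp only [Finsupp.mem_support_iff, not_not, map_sub, Finsupp.sub_apply, hφl, hφr, hy1]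
      simp
    · intro i hi
      simp only [Finsupp.mem_support_iff, map_sub, Finsupp.sub_apply, hφl, hφr] at hi ⊢
      intro h
      apply hi
      simp [hys i h]
  have hcen : ∀ i, ∃ c : F, algebraMap F A c = φ y i := by
    intro i
    have : φ y i ∈ Subalgebra.center F A := by
      rw [Subalgebra.mem_center_iff]
      intro a
      have h := congrArg (fun w => φ w i) (hcomm a)
      simp only [map_sub, Finsupp.sub_apply, hφl, hφr, map_zero, Finsupp.zero_apply] at h
      exact sub_eq_zero.1 h
    exact Algebra.mem_bot.1 (Algebra.IsCentral.out this)
  choose c hc using hcen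
  have hy : y = (∑ i ∈ (φ y).support, c i • b i) ⊗ₜ[F] (1 : A) := by
    have h := φ.symm_apply_apply y
    rw [TensorProduct.equivFinsuppOfBasisLeft_symm_apply] at h
    refine h.symm.trans ?_
    rw [TensorProduct.sum_tmul, Finsupp.sum]
    refine Finset.sum_congr rfl fun i _ => ?_
    rw [← hc, Algebra.algebraMap_eq_smul_one, TensorProduct.tmul_smul, TensorProduct.smul_tmul']
  set l := ∑ i ∈ (φ y).support, c i • b i
  have hl : l ≠ 0 := by
    rintro h
    rw [h, TensorProduct.zero_tmul] at hy
    rw [hy] at hy1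
    simp at hy1
  have h1 : (1 : L ⊗[F] A) ∈ I := by
    have := I.mul_mem_left (l⁻¹ ⊗ₜ 1) _ hyI
    rwa [hy, Algebra.TensorProduct.tmul_mul_tmul, inv_mul_cancel₀ hl, mul_one,
      ← Algebra.TensorProduct.one_def] at this
  rw [eq_top_iff]
  intro z _
  simpa using I.mul_mem_left z _ h1

lemma ar_generic {F L ι J σ : Type*} [Field F] [Field L] [Algebra F L] [Infinite F]
    [Fintype ι] [DecidableEq ι] [Fintype J]
    (P : Matrix ι J (MvPolynomial σ F)) (f0 : σ → L)
    (h : Function.Surjective (P.map (MvPolynomial.aeval f0)).mulVec) :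
    ∃ f1 : σ → F, Function.Surjective (P.map (MvPolynomial.aeval f1)).mulVec := by
  classical
  rw [Matrix.mulVec_surjective_iff_exists_right_inverse] at h
  obtain ⟨R, hR⟩ := h
  let PX : Matrix ι J (MvPolynomial σ L) := P.map (MvPolynomial.map (algebraMap F L))
  let RX : Matrix J ι (MvPolynomial σ L) := R.map MvPolynomial.C
  let Q : MvPolynomial σ L := Matrix.det (PX * RX)
  have hQ : ∀ f : σ → L, MvPolynomial.eval f Q = (P.map (MvPolynomial.aeval f) * R).det := by
    intro f
    change MvPolynomial.eval f (Matrix.det (PX * RX)) = _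
    rw [RingHom.map_det]
    congr 1
    ext i j
    simp [PX, RX, Matrix.mul_apply, MvPolynomial.eval_map, MvPolynomial.aeval_def]
  have hQ0 : Q ≠ 0 := by
    intro h0
    have := hQ f0
    rw [hR, h0] at this
    simp at this
  have hinf : (Set.range (algebraMap F L)).Infinite :=
    Set.infinite_range_of_injective (algebraMap F L).injective
  have : ∃ f1 : σ → F, MvPolynomial.eval (fun i => algebraMap F L (f1 i)) Q ≠ 0 := by
    by_contra! hcon
    apply hQ0
    refine MvPolynomial.funext_set (fun _ => Set.range (algebraMap F L)) (fun _ => hinf) ?_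
    intro x hx
    choose f hf using fun i => hx i (Set.mem_univ i)
    have : x = fun i => algebraMap F L (f i) := by ext i; exact (hf i).symm
    rw [this, hcon, map_zero]
  obtain ⟨f1, hf1⟩ := this
  refine ⟨f1, ?_⟩
  set M := P.map (MvPolynomial.aeval f1) with hM
  have hML : P.map (MvPolynomial.aeval (fun i => algebraMap F L (f1 i)))
      = M.map (algebraMap F L) := by
    ext i j
    simp only [Matrix.map_apply, hM]
    exact MvPolynomial.aeval_algebraMap_apply L f1 (P i j)
  rw [hQ, hML] at hf1
  -- rows of M are linearly independent
  have hrow : LinearIndependent F M.row := by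
    rw [← Matrix.vecMul_injective_iff]
    intro v w hvw
    have hinj := Matrix.vecMul_injective_of_isUnit
      ((Matrix.isUnit_iff_isUnit_det _).2 (isUnit_iff_ne_zero.2 hf1))
    have : (fun i => algebraMap F L (v i)) = fun i => algebraMap F L (w i) := by
      apply hinj
      simp only [← Matrix.vecMul_vecMul]
      congr 1
      ext j
      have := congrArg (algebraMap F L) (congrFun hvw j)
      simpa [Matrix.vecMul, dotProduct] using this
    ext i
    exact (algebraMap F L).injective (congrFun this i)
  have hrk : M.rank = Fintype.card ι := hrow.rank_matrix
  have : LinearMap.range M.mulVecLin = ⊤ := by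
    apply Submodule.eq_top_of_finrank_eq
    rw [← Matrix.rank, hrk, Module.finrank_fintype_fun_eq_card]
  exact LinearMap.range_eq_top.1 this

/-- shift matrix -/
def arN (k : Type*) [CommRing k] (m : ℕ) : Matrix (Fin (m+1)) (Fin (m+1)) k :=
  fun i j => if (i : ℕ) + 1 = j then 1 else 0

/-- the sum of two ad maps -/
def arAd (k : Type*) [CommRing k] {A : Type*} [Ring A] [Algebra k A] (a b : A) : A × A →ₗ[k] A :=
  LinearMap.coprod (LinearMap.mulLeft k a - LinearMap.mulRight k a)
    (LinearMap.mulLeft k b - LinearMap.mulRight k b)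

lemma arAd_apply (k : Type*) [CommRing k] {A : Type*} [Ring A] [Algebra k A] (a b x y : A) :
    arAd k a b (x, y) = (a * x - x * a) + (b * y - y * b) := by
  simp [arAd]

open Matrix in
lemma ar_mul_single {k : Type*} [CommRing k] {n : Type*} [Fintype n] [DecidableEq n]
    (M : Matrix n n k) (i j p q : n) :
    (M * single i j (1 : k)) p q = if j = q then M p i else 0 := by
  by_cases h : j = q
  · subst h; simp
  · rw [if_neg h, mul_single_apply_of_ne]
    exact fun h' => h h'.symm

open Matrix in
lemma ar_single_mul {k : Type*} [CommRing k] {n : Type*} [Fintype n] [DecidableEq n]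
    (M : Matrix n n k) (i j p q : n) :
    (single i j (1 : k) * M) p q = if i = p then M j q else 0 := by
  by_cases h : i = p
  · subst h; simp
  · rw [if_neg h, single_mul_apply_of_ne]
    exact fun h' => h h'.symm

open Matrix in
lemma ar_matrix (k : Type*) [CommRing k] (m : ℕ) (c : Matrix (Fin (m+1)) (Fin (m+1)) k) :
    c - c.trace • single 0 0 1 ∈ LinearMap.range (arAd k (arN k m) (single 0 0 1)) := by
  set W := LinearMap.range (arAd k (arN k m) (single 0 0 1)) with hW
  have hWN : ∀ x, arN k m * x - x * arN k m ∈ W := fun x => ⟨(x, 0), by simp [arAd_apply]⟩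
  have hWE : ∀ y, single 0 0 1 * y - y * single 0 0 1 ∈ W :=
    fun y => ⟨(0, y), by simp [arAd_apply]⟩
  have key : ∀ (i j : ℕ) (hi : i < m + 1) (hj : j < m + 1),
      single (⟨i, hi⟩ : Fin (m+1)) (⟨j, hj⟩ : Fin (m+1)) (1 : k)
        - (if i = j then (1 : k) else 0) • single 0 0 1 ∈ W := by
    intro i
    induction i with
    | zero =>
      intro j hi hj
      rcases j with _ | j
      · simp
      · have h := W.neg_mem (hWN (single 0 ⟨j, by omega⟩ 1))
        convert! h using 1
        ext p q
        simp only [Matrix.sub_apply, Matrix.neg_apply, ar_mul_single, ar_single_mul, Matrix.smul_apply]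
        simp only [arN, single_apply, Fin.ext_iff, Fin.val_zero]
        have hne : ¬ (0 = j + 1) := by omega
        clear h hWN hWE hW
        simp only [hne, if_false, zero_smul]
        split_ifs <;> first | contradiction | omega | (simp; done) | simp_all
    | succ i ih =>
      intro j hi hj
      rcases j with _ | j
      · have h := W.neg_mem (hWE (single ⟨i+1, hi⟩ 0 1))
        convert! h using 1
        simp [single_mul_single_of_ne, Fin.ext_iff]
      · have h := W.sub_mem (ih j (by omega) (by omega))
          (hWN (single ⟨i+1, hi⟩ ⟨j, by omega⟩ 1))
        convert! h using 1
        ext p q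
        simp only [Matrix.sub_apply, ar_mul_single, ar_single_mul, Matrix.smul_apply, add_left_inj]
        generalize (if i = j then (1 : k) else 0) • (single 0 0 1 : Matrix _ _ k) p q = t
        simp only [arN, single_apply, Fin.ext_iff]
        split_ifs <;> first | contradiction | omega | (simp; done) | ring
  have hc : c - c.trace • single 0 0 1 = ∑ i, ∑ j, c i j •
      (single i j (1 : k) - (if (i : ℕ) = j then (1 : k) else 0) • single 0 0 1) := by
    simp only [smul_sub, Finset.sum_sub_distrib, smul_smul, ← Finset.sum_smul]
    congr 1
    · conv_lhs => rw [matrix_eq_sum_single c]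
      simp
    · simp [Matrix.trace, ← Fin.ext_iff, Finset.sum_ite_eq]
  rw [hc]
  exact W.sum_mem fun i _ => W.sum_mem fun j _ => W.smul_mem _ (key i j i.2 j.2)

/-- polynomial matrix of the map `(x, y, t) ↦ [a, x] + [b, y] + t u` with generic `a`, `b` -/
noncomputable def arP {F A ι : Type*} [Field F] [Ring A] [Algebra F A] [Fintype ι]
    (e : Module.Basis ι F A) (u : A) : Matrix ι (ι ⊕ ι ⊕ Unit) (MvPolynomial (ι ⊕ ι) F) :=
  fun k s => match s with
  | Sum.inl i => ∑ l, MvPolynomial.X (Sum.inl l) * MvPolynomial.C (e.repr (e l * e i - e i * e l) k)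
  | Sum.inr (Sum.inl i) =>
      ∑ l, MvPolynomial.X (Sum.inr l) * MvPolynomial.C (e.repr (e l * e i - e i * e l) k)
  | Sum.inr (Sum.inr _) => MvPolynomial.C (e.repr u k)

lemma ar_comm_sum {R C ι : Type*} [Field R] [Ring C] [Algebra R C] [Fintype ι]
    (B : ι → C) (f v : ι → R) :
    (∑ l, f l • B l) * (∑ i, v i • B i) - (∑ i, v i • B i) * (∑ l, f l • B l)
      = ∑ i, v i • ∑ l, f l • (B l * B i - B i * B l) := by
  rw [Finset.sum_mul_sum, Finset.sum_mul_sum, Finset.sum_comm, ← Finset.sum_sub_distrib]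
  refine Finset.sum_congr rfl fun i _ => ?_
  rw [← Finset.sum_sub_distrib, Finset.smul_sum]
  refine Finset.sum_congr rfl fun l _ => ?_
  rw [smul_mul_smul_comm, smul_mul_smul_comm, smul_sub, smul_sub, smul_smul, smul_smul,
    mul_comm (v i)]

lemma ar_col {F A ι R C : Type*} [Field F] [Ring A] [Algebra F A] [Fintype ι]
    (e : Module.Basis ι F A) (u : A) [Field R] [Algebra F R] [Ring C] [Algebra R C]
    (B : Module.Basis ι R C) (j : A →+* C) (hB : ∀ i, B i = j (e i))
    (hr : ∀ x k, B.repr (j x) k = algebraMap F R (e.repr x k))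
    (f : ι ⊕ ι → R) (v : ι ⊕ ι ⊕ Unit → R) (k : ι) :
    ((arP e u).map (MvPolynomial.aeval f)).mulVec v k =
      B.repr ((arAd R (∑ l, f (Sum.inl l) • B l) (∑ l, f (Sum.inr l) • B l))
        (∑ i, v (Sum.inl i) • B i, ∑ i, v (Sum.inr (Sum.inl i)) • B i)
        + v (Sum.inr (Sum.inr ())) • j u) k := by
  rw [arAd_apply, ar_comm_sum (fun i => B i) (fun l => f (Sum.inl l)) (fun i => v (Sum.inl i)),
    ar_comm_sum (fun i => B i) (fun l => f (Sum.inr l)) (fun i => v (Sum.inr (Sum.inl i)))]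
  have h : ∀ l i, B.repr (B l * B i - B i * B l) k
      = algebraMap F R (e.repr (e l * e i - e i * e l) k) := by
    intro l i
    rw [← hr, map_sub j, map_mul j, map_mul j, hB, hB]
  simp only [Matrix.mulVec, dotProduct, Fintype.sum_sum_type, Matrix.map_apply, arP]
  simp only [map_add, map_sum, map_smul, Finsupp.add_apply, Finsupp.finsetSum_apply,
    Finsupp.smul_apply, h, hr, smul_eq_mul, map_mul, MvPolynomial.aeval_X, MvPolynomial.aeval_C,
    Finset.univ_unique, Finset.sum_singleton, PUnit.default_eq_unit]
  simp only [mul_comm (v _)]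
  ring

theorem ar_infinite (F A : Type*) [Field F] [Infinite F] [Ring A] [Algebra F A]
    [FiniteDimensional F A] [IsSimpleRing A] [Algebra.IsCentral F A] (z : A)
    (hz : z ∈ AddSubgroup.closure {x : A | ∃ a b : A, x = a * b - b * a}) :
    ∃ a₁ b₁ a₂ b₂ : A, z = (a₁ * b₁ - b₁ * a₁) + (a₂ * b₂ - b₂ * a₂) := by
  classical
  let L := AlgebraicClosure F
  haveI := ar_simple_tensor F L A
  obtain ⟨n, hn, ⟨Φ⟩⟩ := IsSimpleRing.exists_algEquiv_matrix_of_isAlgClosed L (L ⊗[F] A)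
  obtain ⟨m, rfl⟩ : ∃ m, n = m + 1 := Nat.exists_eq_succ_of_ne_zero hn.out
  let e := Module.finBasis F A
  let B := (e.baseChange L).map Φ.toLinearEquiv
  let j : A →+* Matrix (Fin (m+1)) (Fin (m+1)) L :=
    (Φ : L ⊗[F] A →+* Matrix (Fin (m+1)) (Fin (m+1)) L).comp
      (Algebra.TensorProduct.includeRight : A →ₐ[F] L ⊗[F] A).toRingHom
  have hj : ∀ x, j x = Φ (1 ⊗ₜ x) := fun x => rfl
  have hB : ∀ i, B i = j (e i) := by
    intro i
    simp [B, hj]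
  have hr : ∀ x k, B.repr (j x) k = algebraMap F L (e.repr x k) := by
    intro x k
    have : Φ.toLinearEquiv.symm (Φ (1 ⊗ₜ x)) = 1 ⊗ₜ x := Φ.symm_apply_apply _
    simp only [B, hj, Module.Basis.map_repr, LinearEquiv.trans_apply, this]
    rw [Module.Basis.baseChange_repr_tmul, Algebra.algebraMap_eq_smul_one]
  have htr : ∀ x ∈ AddSubgroup.closure {x : A | ∃ a b : A, x = a * b - b * a},
      (j x).trace = 0 := by
    intro x hx
    induction hx using AddSubgroup.closure_induction with
    | mem x hx =>
      obtain ⟨a, b, rfl⟩ := hx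
      rw [map_sub, map_mul, map_mul, Matrix.trace_sub, Matrix.trace_mul_comm, sub_self]
    | zero => simp
    | add x y _ _ hx hy => rw [map_add, Matrix.trace_add, hx, hy, add_zero]
    | neg x _ hx => rw [map_neg, Matrix.trace_neg, hx, neg_zero]
  have hu : ∃ u : A, (j u).trace ≠ 0 := by
    by_contra! hcon
    have h0 : Matrix.traceLinearMap (Fin (m+1)) L L = 0 := by
      apply B.ext
      intro i
      rw [hB]
      exact hcon _
    have h1 := LinearMap.congr_fun h0 (Matrix.single 0 0 1)
    simp at h1
  obtain ⟨u, hu⟩ := hu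
  have hsurj : Function.Surjective ((arP e u).map (MvPolynomial.aeval
      (Sum.elim (fun i => B.repr (arN L m) i) (fun i => B.repr (Matrix.single 0 0 1) i)))).mulVec := by
    intro w
    let c := B.equivFun.symm w
    let t := c.trace / (j u).trace
    obtain ⟨⟨x, y⟩, hxy⟩ := ar_matrix L m (c - t • j u)
    have ht : (c - t • j u).trace = 0 := by
      rw [Matrix.trace_sub, Matrix.trace_smul, smul_eq_mul, div_mul_cancel₀ _ hu, sub_self]
    rw [ht, zero_smul, sub_zero] at hxy
    refine ⟨Sum.elim (fun i => B.repr x i) (Sum.elim (fun i => B.repr y i) fun _ => t), ?_⟩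
    ext k
    rw [ar_col e u B j hB hr]
    simp only [Sum.elim_inl, Sum.elim_inr, Module.Basis.sum_repr]
    rw [hxy, sub_add_cancel]
    exact congrFun (B.equivFun.apply_symm_apply w) k
  obtain ⟨f1, hf1⟩ := ar_generic (arP e u) _ hsurj
  obtain ⟨v, hv⟩ := hf1 (fun k => e.repr z k)
  have hz' := fun k => (congrFun hv k).symm.trans
    (ar_col e u e (RingHom.id A) (fun _ => rfl) (fun _ _ => rfl) f1 v k)
  have hz2 := e.repr.injective (Finsupp.ext hz')
  rw [arAd_apply] at hz2
  generalize (∑ l, f1 (Sum.inl l) • e l) = a at hz2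
  generalize (∑ l, f1 (Sum.inr l) • e l) = b at hz2
  generalize (∑ i, v (Sum.inl i) • e i) = x at hz2
  generalize (∑ i, v (Sum.inr (Sum.inl i)) • e i) = y at hz2
  generalize v (Sum.inr (Sum.inr ())) = t at hz2
  rw [RingHom.id_apply] at hz2
  have hju : j (t • u) = algebraMap F L t • j u := by
    apply B.ext_elem
    intro k
    rw [hr, map_smul, map_smul, Finsupp.smul_apply, Finsupp.smul_apply, hr, smul_eq_mul,
      smul_eq_mul, map_mul]
  have htu : (j (t • u)).trace = 0 := by
    have h2 : t • u = z - ((a * x - x * a) + (b * y - y * b)) := by rw [hz2]; abel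
    rw [h2]
    apply htr
    exact AddSubgroup.sub_mem _ hz (AddSubgroup.add_mem _
      (AddSubgroup.subset_closure ⟨_, _, rfl⟩) (AddSubgroup.subset_closure ⟨_, _, rfl⟩))
  rw [hju, Matrix.trace_smul, smul_eq_mul, mul_eq_zero, or_iff_left hu] at htu
  have ht : t = 0 := by simpa using htu
  rw [ht, zero_smul, add_zero] at hz2
  exact ⟨a, x, b, y, hz2⟩

theorem ar_split (A k : Type*) [Ring A] [CommRing k] (m : ℕ)
    (Φ : A ≃+* Matrix (Fin (m+1)) (Fin (m+1)) k) (z : A)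
    (hz : z ∈ AddSubgroup.closure {x : A | ∃ a b : A, x = a * b - b * a}) :
    ∃ a₁ b₁ a₂ b₂ : A, z = (a₁ * b₁ - b₁ * a₁) + (a₂ * b₂ - b₂ * a₂) := by
  have htr : (Φ z).trace = 0 := by
    induction hz using AddSubgroup.closure_induction with
    | mem x hx =>
      obtain ⟨a, b, rfl⟩ := hx
      rw [map_sub, map_mul, map_mul, Matrix.trace_sub, Matrix.trace_mul_comm, sub_self]
    | zero => simp
    | add x y _ _ hx hy => rw [map_add, Matrix.trace_add, hx, hy, add_zero]
    | neg x _ hx => rw [map_neg, Matrix.trace_neg, hx, neg_zero]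
  obtain ⟨⟨x, y⟩, hxy⟩ := ar_matrix k m (Φ z)
  rw [htr, zero_smul, sub_zero, arAd_apply] at hxy
  refine ⟨Φ.symm (arN k m), Φ.symm x, Φ.symm (Matrix.single 0 0 1), Φ.symm y, ?_⟩
  apply Φ.injective
  simp [← hxy]

theorem ar_finite (A : Type*) [Ring A] [Finite A] [IsSimpleRing A] (z : A)
    (hz : z ∈ AddSubgroup.closure {x : A | ∃ a b : A, x = a * b - b * a}) :
    ∃ a₁ b₁ a₂ b₂ : A, z = (a₁ * b₁ - b₁ * a₁) + (a₂ * b₂ - b₂ * a₂) := by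
  obtain ⟨n, hn, D, hD, ⟨Φ⟩⟩ := IsSimpleRing.exists_ringEquiv_matrix_divisionRing A
  obtain ⟨m, rfl⟩ : ∃ m, n = m + 1 := Nat.exists_eq_succ_of_ne_zero hn.out
  haveI : Finite D := Finite.of_injective (fun d : D => Φ.symm (fun _ _ => d)) (by
    intro c d h
    exact congrFun (congrFun (Φ.symm.injective h) 0) 0)
  letI : Field D := littleWedderburn D
  exact ar_split A D m Φ z hz

theorem amitsur_rowen_commutator_width
    (K : Type*) [Field K] (A : Type*) [Ring A] [Algebra K A]
    [FiniteDimensional K A] [IsSimpleRing A] :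
    ∀ z ∈ Submodule.span K {x : A | ∃ a b : A, x = a * b - b * a},
      ∃ a₁ b₁ a₂ b₂ : A, z = (a₁ * b₁ - b₁ * a₁) + (a₂ * b₂ - b₂ * a₂) := by
  intro z hz
  have hz' : z ∈ AddSubgroup.closure {x : A | ∃ a b : A, x = a * b - b * a} := by
    induction hz using Submodule.span_induction with
    | mem x hx => exact AddSubgroup.subset_closure hx
    | zero => exact AddSubgroup.zero_mem _
    | add x y _ _ hx hy => exact AddSubgroup.add_mem _ hx hy
    | smul c x hxs hx =>
      clear hxs
      induction hx using AddSubgroup.closure_induction with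
      | mem x hx =>
        obtain ⟨a, b, rfl⟩ := hx
        exact AddSubgroup.subset_closure ⟨c • a, b, by simp [smul_sub]⟩
      | zero => rw [smul_zero]; exact AddSubgroup.zero_mem _
      | add x y _ _ hx hy => rw [smul_add]; exact AddSubgroup.add_mem _ hx hy
      | neg x _ hx => rw [smul_neg]; exact AddSubgroup.neg_mem _ hx
  rcases finite_or_infinite K with hK | hK
  · haveI : Finite A := Module.finite_of_finite K
    exact ar_finite A z hz'
  · letI : Field (Subring.center A) := (IsSimpleRing.isField_center A).toField
    have hmem : ∀ k : K, algebraMap K A k ∈ Subring.center A := fun k =>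
      Subring.mem_center_iff.2 fun a => (Algebra.commutes k a).symm
    haveI : Infinite (Subring.center A) :=
      Infinite.of_injective (fun k : K => (⟨algebraMap K A k, hmem k⟩ : Subring.center A)) (by
        intro a b h
        exact (algebraMap K A).injective (congrArg Subtype.val h))
    haveI : FiniteDimensional (Subring.center A) A := by
      obtain ⟨s, hs⟩ := (Module.Finite.fg_top : (⊤ : Submodule K A).FG)
      refine ⟨⟨s, ?_⟩⟩
      rw [eq_top_iff]
      intro x _
      have hx : x ∈ Submodule.span K (s : Set A) := by rw [hs]; trivial
      induction hx using Submodule.span_induction with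
      | mem x hx => exact Submodule.subset_span hx
      | zero => exact Submodule.zero_mem _
      | add x y _ _ hx hy => exact Submodule.add_mem _ (hx trivial) (hy trivial)
      | smul c x _ hx =>
        have h := Submodule.smul_mem _ (⟨algebraMap K A c, hmem c⟩ : Subring.center A) (hx trivial)
        rw [Algebra.smul_def]
        exact h
    haveI : Algebra.IsCentral (Subring.center A) A := ⟨fun x hx => by
      rw [Subalgebra.mem_center_iff] at hx
      exact Algebra.mem_bot.2 ⟨⟨x, Subring.mem_center_iff.2 hx⟩, rfl⟩⟩
    exact ar_infinite (Subring.center A) A z hz'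
end

section
/- Let K be a commutative unital ring and let A be a unital associative K-algebra such that A is equal to its commutator ideal A[A,A]A, the two-sided ideal of A generated by all commutators [a,b] = ab − ba. Then A equals the K-linear span of h(A) = {[a,b][c,d] | a,b,c,d ∈ A}, and moreover there exists N ≥ 1 such that every element of A is a K-linear combination of at most N elements of h(A); that is, the polynomial h = [X₁,X₂][X₃,X₄] has finite width in A. -/
namespace GardellaThiel

/-- A proper left ideal-like prime argument: if every product of commutator-brackets lies in a
two-sided proper set `J`, then commutators do not generate. -/
theorem one_mem_of {A : Type*} [Ring A]
    (hA : TwoSidedIdeal.span {x : A | ∃ a b : A, x = a * b - b * a} = ⊤)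
    (J : Ideal A) (hJr : ∀ x ∈ J, ∀ r, x * r ∈ J)
    (hJ : ∀ a b c d : A, (a * b - b * a) * (c * d - d * c)
      - (c * d - d * c) * (a * b - b * a) ∈ J) : J = ⊤ := by
  by_contra hne
  obtain ⟨M, hM, hJM⟩ := Ideal.exists_le_maximal J hne
  let P : TwoSidedIdeal A := TwoSidedIdeal.mk' {a | ∀ r, a * r ∈ M}
    (by intro r; simp)
    (by intro x y hx hy r; rw [add_mul]; exact M.add_mem (hx r) (hy r))
    (by intro x hx r; rw [neg_mul]; exact M.neg_mem (hx r))
    (by intro x y hy r; rw [mul_assoc]; exact M.mul_mem_left _ (hy r))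
    (by intro x y hx r; rw [mul_assoc]; exact hx _)
  have hP : ∀ a, a ∈ P ↔ ∀ r, a * r ∈ M := by
    intro a
    exact TwoSidedIdeal.mem_mk' _ _ _ _ _ _ a
  have hJP : ∀ a ∈ J, a ∈ P := fun a ha => (hP a).2 fun r => hJM (hJr a ha r)
  have prime : ∀ w, (∀ y, w * y * w ∈ P) → w ∈ P := by
    intro w hw
    by_contra hwP
    rw [hP] at hwP
    push Not at hwP
    obtain ⟨c, hc⟩ := hwP
    obtain ⟨t, m, hm, htm⟩ : ∃ t, ∃ m ∈ M, t * (w * c) + m = 1 := by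
      have h1 : (1 : A) ∈ Ideal.span {w * c} ⊔ M := by
        have : Ideal.span {w * c} ⊔ M = ⊤ := by
          apply hM.1.2
          refine lt_of_le_of_ne le_sup_right ?_
          intro h
          apply hc
          rw [h]
          exact (le_sup_left : Ideal.span {w * c} ≤ _) (Ideal.subset_span rfl)
        rw [this]; trivial
      obtain ⟨y, hy, z, hz, hyz⟩ := Submodule.mem_sup.1 h1
      obtain ⟨t, rfl⟩ := Ideal.mem_span_singleton'.1 hy
      exact ⟨t, z, hz, hyz⟩
    apply hc
    have h2 := (hP _).1 (hw (c * t)) c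
    have : w * c = w * (c * t) * w * c + w * c * m := by
      calc w * c = w * c * (t * (w * c) + m) := by rw [htm, mul_one]
        _ = _ := by noncomm_ring
    rw [this]
    exact M.add_mem h2 (M.mul_mem_left _ hm)
  have hL : ∀ a b c d : A, (a * b - b * a) * (c * d - d * c)
      - (c * d - d * c) * (a * b - b * a) ∈ P := fun a b c d => hJP _ (hJ a b c d)
  have s1 : ∀ x y p q : A, (x * (p * q - q * p) - (p * q - q * p) * x) * (x * y - y * x) ∈ P := by
    intro x y p q
    have := P.sub_mem (hL x (x * y) p q) (P.mul_mem_left x _ (hL x y p q))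
    convert this using 1
    noncomm_ring
  have s2 : ∀ x p q : A, x * (p * q - q * p) - (p * q - q * p) * x ∈ P := by
    intro x p q
    apply prime
    intro y
    have := P.sub_mem (s1 x (y * (p * q - q * p)) p q)
      (P.mul_mem_right _ (p * q - q * p) (s1 x y p q))
    convert this using 1
    generalize p * q - q * p = v
    noncomm_ring
  have s3 : ∀ x y : A, x * y - y * x ∈ P := by
    intro x y
    have h1 : (x * y - y * x) * (x * y - y * x) ∈ P := by
      have e1 := s2 y x (x * y)
      have e2 := P.mul_mem_left x _ (s2 y x y)
      have := P.sub_mem e2 e1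
      convert this using 1
      noncomm_ring
    apply prime
    intro r
    have := P.add_mem (P.mul_mem_right _ r h1) (P.mul_mem_left (x * y - y * x) _ (s2 r x y))
    convert this using 1
    generalize x * y - y * x = v
    noncomm_ring
  have hPt : (1 : A) ∈ P := by
    have h : (1 : A) ∈ TwoSidedIdeal.span {x : A | ∃ a b : A, x = a * b - b * a} := by
      rw [hA]; trivial
    refine TwoSidedIdeal.mem_span_iff.1 h P ?_
    rintro _ ⟨a, b, rfl⟩
    exact s3 a b
  apply hM.ne_top
  rw [Ideal.eq_top_iff_one]
  simpa using (hP 1).1 hPt 1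

theorem span_top (K : Type*) [CommRing K] (A : Type*) [Ring A] [Algebra K A]
    (hA : TwoSidedIdeal.span {x : A | ∃ a b : A, x = a * b - b * a} = ⊤) :
    Submodule.span K
        {x : A | ∃ a b c d : A, x = (a * b - b * a) * (c * d - d * c)} = ⊤ := by
  let L : Submodule K A := Submodule.span K {x : A | ∃ a b : A, x = a * b - b * a}
  have hLL : Submodule.span K
      {x : A | ∃ a b c d : A, x = (a * b - b * a) * (c * d - d * c)} = L * L := by
    rw [Submodule.span_mul_span]
    congr 1
    ext x
    constructor
    · rintro ⟨a, b, c, d, rfl⟩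
      exact Set.mul_mem_mul ⟨a, b, rfl⟩ ⟨c, d, rfl⟩
    · rintro ⟨_, ⟨a, b, rfl⟩, _, ⟨c, d, rfl⟩, rfl⟩
      exact ⟨a, b, c, d, rfl⟩
  rw [hLL]
  have hc : ∀ a b : A, a * b - b * a ∈ L := fun a b => Submodule.subset_span ⟨a, b, rfl⟩
  have hm : ∀ u ∈ L, ∀ v ∈ L, u * v ∈ L * L := fun u hu v hv => Submodule.mul_mem_mul hu hv
  have hcL : ∀ s ∈ L * L, ∀ a : A, s * a - a * s ∈ L * L := by
    intro s hs a
    induction hs using Submodule.mul_induction_on' with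
    | mem_mul_mem u hu v hv =>
      have := (L * L).add_mem (hm u hu _ (hc v a)) (hm _ (hc u a) v hv)
      convert this using 1
      noncomm_ring
    | add x _ y _ hx hy =>
      have := (L * L).add_mem hx hy
      convert this using 1
      noncomm_ring
  have k1 : ∀ x : A, ∀ u ∈ L, ∀ v ∈ L, x * (u * v - v * u) ∈ L ⊔ L * L := by
    intro x u hu v hv
    have := (L ⊔ L * L).sub_mem ((le_sup_left : L ≤ L ⊔ L * L) (hc (x * u) v))
      ((le_sup_right : L * L ≤ L ⊔ L * L) (hm _ (hc x v) u hu))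
    convert this using 1
    noncomm_ring
  have k2 : ∀ x d : A, ∀ u ∈ L, ∀ v ∈ L, x * (u * v - v * u) * d ∈ L ⊔ L * L := by
    intro x d u hu v hv
    have := (L ⊔ L * L).add_mem (k1 (x * d) u hu v hv)
      ((L ⊔ L * L).add_mem (k1 x _ (hc u d) v hv) (k1 x u hu _ (hc v d)))
    convert this using 1
    noncomm_ring
  let J : Ideal A :=
    { carrier := {y | ∀ x d : A, x * y * d ∈ L ⊔ L * L}
      add_mem' := by
        intro a b ha hb x d
        rw [mul_add, add_mul]
        exact Submodule.add_mem _ (ha x d) (hb x d)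
      zero_mem' := by intro x d; simp
      smul_mem' := by
        intro c a ha x d
        rw [smul_eq_mul, ← mul_assoc]
        exact ha _ _ }
  have hJ : J = ⊤ := by
    apply one_mem_of hA J
    · intro y hy r x d
      have := hy x (r * d)
      convert this using 1
      noncomm_ring
    · intro a b c d x e
      exact k2 x e _ (hc a b) _ (hc c d)
  have hT : ∀ x : A, x ∈ L ⊔ L * L := by
    intro x
    have h1 : x ∈ J := by rw [hJ]; trivial
    simpa using h1 1 1
  have q1 : ∀ u ∈ L, ∀ a : A, u * a - a * u ∈ L * L := by
    intro u hu a
    obtain ⟨v, hv, s, hs, rfl⟩ := Submodule.mem_sup.1 (hT a)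
    have := (L * L).sub_mem ((L * L).sub_mem (hm u hu v hv) (hm v hv u hu)) (hcL s hs u)
    convert this using 1
    noncomm_ring
  have q2 : L ≤ L * L := by
    apply Submodule.span_le.2
    rintro _ ⟨a, b, rfl⟩
    obtain ⟨v, hv, s, hs, rfl⟩ := Submodule.mem_sup.1 (hT a)
    have := (L * L).add_mem (q1 v hv b) (hcL s hs b)
    show _ ∈ L * L
    convert this using 1
    noncomm_ring
  rw [eq_top_iff]
  intro x _
  exact (sup_le q2 le_rfl : L ⊔ L * L ≤ L * L) (hT x)

theorem pi_top (A : Type*) [Ring A]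
    (hA : TwoSidedIdeal.span {x : A | ∃ a b : A, x = a * b - b * a} = ⊤) :
    TwoSidedIdeal.span {x : ℕ → A | ∃ a b : ℕ → A, x = a * b - b * a} = ⊤ := by
  have h1 : (1 : A) ∈ (TwoSidedIdeal.span
      {x : ℕ → A | ∃ a b : ℕ → A, x = a * b - b * a}).comap (Pi.constRingHom ℕ A) := by
    have h : (1 : A) ∈ TwoSidedIdeal.span {x : A | ∃ a b : A, x = a * b - b * a} := by
      rw [hA]; trivial
    refine TwoSidedIdeal.mem_span_iff.1 h _ ?_
    rintro _ ⟨a, b, rfl⟩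
    rw [SetLike.mem_coe, TwoSidedIdeal.mem_comap]
    refine TwoSidedIdeal.subset_span ⟨fun _ => a, fun _ => b, ?_⟩
    rfl
  rw [TwoSidedIdeal.mem_comap, map_one] at h1
  rw [eq_top_iff]
  intro x _
  simpa using TwoSidedIdeal.mul_mem_left _ x _ h1

end GardellaThiel

/-- Theorem of Gardella and Thiel: if a unital algebra `A` over a commutative unital
ring `K` equals its commutator ideal (the two-sided ideal generated by all commutators),
then `A` is the linear span of `h(A) = {[a,b][c,d]}` and the polynomial
`h = [X₁,X₂][X₃,X₄]` has finite width in `A`: there is `N ≥ 1` such that every element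
of `A` is a linear combination of at most `N` elements of `h(A)`. -/
theorem gardella_thiel_product_of_commutators
    (K : Type*) [CommRing K] (A : Type*) [Ring A] [Algebra K A]
    (hA : TwoSidedIdeal.span {x : A | ∃ a b : A, x = a * b - b * a} = ⊤) :
    Submodule.span K
        {x : A | ∃ a b c d : A, x = (a * b - b * a) * (c * d - d * c)} = ⊤ ∧
    ∃ N : ℕ, 1 ≤ N ∧ ∀ z : A,
      ∃ (c : Fin N → K) (s : Fin N → A),
        (∀ j, ∃ a b cc dd : A, s j = (a * b - b * a) * (cc * dd - dd * cc)) ∧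
        z = ∑ j, c j • s j := by
  refine ⟨GardellaThiel.span_top K A hA, ?_⟩
  by_contra hcon
  push Not at hcon
  choose z hz using fun n : ℕ => hcon (n + 1) (Nat.le_add_left 1 n)
  have hzt : z ∈ Submodule.span K {x : ℕ → A | ∃ a b c d : ℕ → A,
      x = (a * b - b * a) * (c * d - d * c)} := by
    rw [GardellaThiel.span_top K (ℕ → A) (GardellaThiel.pi_top A hA)]; trivial
  obtain ⟨n, f, g, hfg⟩ := Submodule.mem_span_set'.1 hzt
  refine hz n (Fin.cons 0 f) (Fin.cons 0 fun i => (g i : ℕ → A) n) ?_ ?_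
  · intro j
    refine Fin.cases ?_ ?_ j
    · exact ⟨0, 0, 0, 0, by simp⟩
    · intro i
      obtain ⟨a, b, c, d, h⟩ := (g i).2
      refine ⟨a n, b n, c n, d n, ?_⟩
      rw [Fin.cons_succ, h]
      rfl
  · rw [Fin.sum_univ_succ, ← hfg]
    simp
end
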